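/- Let G = T × D as above. The direct summand property holds for the G-action on V if and only if it holds for the T-action on V^D. -/

import Mathlib

open MvPolynomial

set_option synthInstance.maxHeartbeats 1000000
set_option maxHeartbeats 1000000

variable {k : Type*} [Field k] {ι : Type*} [Fintype ι] [DecidableEq ι]

noncomputable def galAct (M : Matrix.GeneralLinearGroup ι k) :
    MvPolynomial ι k →ₐ[k] MvPolynomial ι k :=
  aeval fun i => ∑ j, (((M⁻¹ : Matrix.GeneralLinearGroup ι k) : Matrix ι ι k) i j) • X j

def invariants (G : Subgroup (Matrix.GeneralLinearGroup ι k)) :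
    Subalgebra k (MvPolynomial ι k) where
  carrier := {p | ∀ σ ∈ G, galAct σ p = p}
  mul_mem' := fun ha hb σ hσ => by rw [map_mul, ha σ hσ, hb σ hσ]
  add_mem' := fun ha hb σ hσ => by rw [map_add, ha σ hσ, hb σ hσ]
  algebraMap_mem' := fun r σ hσ => by simp [galAct]

noncomputable def fixedSpace (M : Matrix.GeneralLinearGroup ι k) : Submodule k (ι → k) :=
  LinearMap.ker (Matrix.mulVecLin ((M : Matrix ι ι k) - 1))

noncomputable def moveSpace (M : Matrix.GeneralLinearGroup ι k) : Submodule k (ι → k) :=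
  LinearMap.range (Matrix.mulVecLin ((M : Matrix ι ι k) - 1))

def IsPseudoReflection (M : Matrix.GeneralLinearGroup ι k) : Prop :=
  Module.finrank k (moveSpace M) = 1

def IsTransvection (M : Matrix.GeneralLinearGroup ι k) : Prop :=
  IsPseudoReflection M ∧ moveSpace M ≤ fixedSpace M

noncomputable def linForm (y : Module.Dual k (ι → k)) : MvPolynomial ι k :=
  ∑ i, C (y (Pi.single i 1)) * X i

noncomputable def hilbertIdeal (G : Subgroup (Matrix.GeneralLinearGroup ι k)) :
    Ideal (MvPolynomial ι k) :=
  Ideal.span {p | p ∈ invariants G ∧ ∃ d, 0 < d ∧ p.IsHomogeneous d}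

def DSP (G : Subgroup (Matrix.GeneralLinearGroup ι k)) : Prop :=
  ∃ π : MvPolynomial ι k →ₗ[↥(invariants G)] ↥(invariants G),
    Function.Surjective π ∧
    ∀ (p : MvPolynomial ι k) (d : ℕ), p.IsHomogeneous d →
      ((π p : MvPolynomial ι k)).IsHomogeneous d

noncomputable def fixedSubmodule (G : Subgroup (Matrix.GeneralLinearGroup ι k)) :
    Submodule k (ι → k) := ⨅ σ ∈ G, fixedSpace σ

/-- The block-diagonal embedding `GL(V^D) × GL(V_D) → GL(V^D ⊕ V_D)`. -/
noncomputable def blockHom {k : Type*} [Field k] {α β : Type*} [Fintype α] [DecidableEq α]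
    [Fintype β] [DecidableEq β] :
    Matrix.GeneralLinearGroup α k × Matrix.GeneralLinearGroup β k →*
      Matrix.GeneralLinearGroup (α ⊕ β) k where
  toFun p :=
    ⟨Matrix.fromBlocks (p.1 : Matrix α α k) 0 0 (p.2 : Matrix β β k),
     Matrix.fromBlocks ((p.1⁻¹ : Matrix.GeneralLinearGroup α k) : Matrix α α k) 0 0
       ((p.2⁻¹ : Matrix.GeneralLinearGroup β k) : Matrix β β k),
     by
      rw [Matrix.fromBlocks_multiply]
      simp only [Matrix.mul_zero, Matrix.zero_mul, add_zero, zero_add]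
      rw [← Units.val_mul, ← Units.val_mul, mul_inv_cancel, mul_inv_cancel]
      simp [← Matrix.fromBlocks_one],
     by
      rw [Matrix.fromBlocks_multiply]
      simp only [Matrix.mul_zero, Matrix.zero_mul, add_zero, zero_add]
      rw [← Units.val_mul, ← Units.val_mul, inv_mul_cancel, inv_mul_cancel]
      simp [← Matrix.fromBlocks_one]⟩
  map_one' := by
    ext : 1
    simp [← Matrix.fromBlocks_one]
  map_mul' p q := by
    ext : 1
    show Matrix.fromBlocks _ _ _ _ = Matrix.fromBlocks _ _ _ _ * Matrix.fromBlocks _ _ _ _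
    rw [Matrix.fromBlocks_multiply]
    simp

/-- A homology: a pseudo-reflection that is not a transvection (it is then diagonalizable). -/
def IsHomology {k : Type*} [Field k] {ι : Type*} [Fintype ι] [DecidableEq ι]
    (M : Matrix.GeneralLinearGroup ι k) : Prop :=
  IsPseudoReflection M ∧ ¬ moveSpace M ≤ fixedSpace M

section PolynomialAction

@[simp]
lemma galAct_X (σ : Matrix.GeneralLinearGroup ι k) (i : ι) :
    galAct σ (X i) =
      ∑ j, (((σ⁻¹ : Matrix.GeneralLinearGroup ι k) : Matrix ι ι k) i j) • X j := by
  simp [galAct]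

lemma galAct_mul_apply (σ τ : Matrix.GeneralLinearGroup ι k) (p : MvPolynomial ι k) :
    galAct (σ * τ) p = galAct σ (galAct τ p) := by
  have h : galAct (σ * τ) = (galAct σ).comp (galAct τ) := by
    ext1 i
    simp only [galAct_X, AlgHom.comp_apply, map_sum, map_smul, mul_inv_rev, Units.val_mul,
      Matrix.mul_apply, Finset.sum_smul, Finset.smul_sum, smul_smul]
    exact Finset.sum_comm
  rw [h, AlgHom.comp_apply]

lemma isHomogeneous_galAct (σ : Matrix.GeneralLinearGroup ι k) {p : MvPolynomial ι k} {d : ℕ}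
    (hp : p.IsHomogeneous d) : (galAct σ p).IsHomogeneous d := by
  have h := hp.aeval
    (fun i => ∑ j, (((σ⁻¹ : Matrix.GeneralLinearGroup ι k) : Matrix ι ι k) i j) •
      (X j : MvPolynomial ι k)) (n := 1) fun i =>
    (homogeneousSubmodule ι k 1).sum_mem fun j _ =>
      (homogeneousSubmodule ι k 1).smul_mem _ (isHomogeneous_X k j)
  rwa [one_mul] at h

end PolynomialAction

/-- The direct summand property amounts to a degree-preserving retraction onto the invariants. -/
lemma dsp_iff_exists_retraction (G : Subgroup (Matrix.GeneralLinearGroup ι k)) :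
    DSP G ↔ ∃ φ : MvPolynomial ι k →+ MvPolynomial ι k,
      (∀ p, φ p ∈ invariants G) ∧ (∀ f ∈ invariants G, ∀ p, φ (f * p) = f * φ p) ∧ φ 1 = 1 ∧
      ∀ p d, p.IsHomogeneous d → (φ p).IsHomogeneous d := by
  constructor
  · rintro ⟨π, hsurj, hdeg⟩
    obtain ⟨c, hc⟩ : ∃ c : k, (π 1 : MvPolynomial ι k) = C c := by
      refine ⟨_, totalDegree_eq_zero_iff_eq_C.mp ?_⟩
      exact Nat.le_zero.mp (hdeg 1 0 (isHomogeneous_one ι k)).totalDegree_le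
    have hsmul : ∀ f ∈ invariants G, ∀ p, (π (f * p) : MvPolynomial ι k) = f * π p :=
      fun f hf p => congrArg Subtype.val (π.map_smul ⟨f, hf⟩ p)
    have hc0 : c ≠ 0 := by
      rintro rfl
      obtain ⟨p, hp⟩ := hsurj 1
      have hp' : (π p : MvPolynomial ι k) = 1 := congrArg Subtype.val hp
      have hdec : (π p : MvPolynomial ι k) =
          ∑ i ∈ Finset.range (p.totalDegree + 1),
            (π (homogeneousComponent i p) : MvPolynomial ι k) := by
        conv_lhs => rw [← sum_homogeneousComponent p]
        rw [map_sum, AddSubmonoidClass.coe_finsetSum]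
      have hzero : coeff 0 (π p : MvPolynomial ι k) = 0 := by
        rw [hdec, coeff_sum]
        refine Finset.sum_eq_zero fun i _ => ?_
        rcases Nat.eq_zero_or_pos i with rfl | hi
        · have h := hsmul _ ((invariants G).algebraMap_mem (coeff 0 p)) 1
          rw [mul_one, algebraMap_eq, hc] at h
          rw [homogeneousComponent_zero, h]
          simp
        · refine (hdeg _ i (homogeneousComponent_isHomogeneous i p)).coeff_eq_zero ?_
          simpa using hi.ne
      rw [hp', coeff_zero_one] at hzero
      exact one_ne_zero hzero
    refine ⟨(AddMonoidHom.mulLeft (C c⁻¹)).comp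
        ((invariants G).val.toRingHom.toAddMonoidHom.comp π.toAddMonoidHom), ?_, ?_, ?_, ?_⟩
    · exact fun p => (invariants G).mul_mem ((invariants G).algebraMap_mem c⁻¹) (π p).2
    · intro f hf p
      change C c⁻¹ * (π (f * p) : MvPolynomial ι k) = f * (C c⁻¹ * (π p : MvPolynomial ι k))
      rw [hsmul f hf, mul_left_comm]
    · change C c⁻¹ * (π 1 : MvPolynomial ι k) = 1
      rw [hc, ← C_mul, inv_mul_cancel₀ hc0, C_1]
    · exact fun p d hp => (hdeg p d hp).C_mul c⁻¹
  · rintro ⟨φ, hmem, hmul, hone, hdeg⟩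
    refine ⟨{ toFun := fun p => ⟨φ p, hmem p⟩
              map_add' := fun p q => Subtype.ext (map_add φ p q)
              map_smul' := fun f p => Subtype.ext (hmul f f.2 p) }, ?_, hdeg⟩
    intro f
    refine ⟨f, Subtype.ext ?_⟩
    have h := hmul f f.2 1
    rwa [mul_one, hone, mul_one] at h

section HomologyOrder

/-- A homology of finite order has order prime to the characteristic. -/
lemma IsHomology.exists_pow_eq_one {σ : Matrix.GeneralLinearGroup ι k} (hσ : IsHomology σ)
    (hfin : IsOfFinOrder σ) : ∃ n : ℕ, (n : k) ≠ 0 ∧ σ ^ n = 1 := by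
  obtain ⟨hrefl, hmove⟩ := hσ
  set A : Matrix ι ι k := (σ : Matrix ι ι k) - 1 with hA
  obtain ⟨⟨v, hv⟩, hv0, hspan⟩ := finrank_eq_one_iff'.mp hrefl
  have hspan' : ∀ w, ∃ c : k, c • v = A.mulVec w := fun w =>
    (hspan ⟨A.mulVec w, w, rfl⟩).imp fun c hc => congrArg Subtype.val hc
  obtain ⟨μ, hμ⟩ := hspan' v
  have hsq : A * A = μ • A := by
    refine Matrix.mulVec_injective (funext fun w => ?_)
    obtain ⟨c, hc⟩ := hspan' w
    rw [← Matrix.mulVec_mulVec, Matrix.smul_mulVec, ← hc, Matrix.mulVec_smul, ← hμ, smul_comm]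
  have hμ0 : μ ≠ 0 := by
    rintro rfl
    apply hmove
    rintro _ ⟨w, rfl⟩
    change A.mulVec (A.mulVec w) = 0
    rw [Matrix.mulVec_mulVec, hsq, zero_smul, Matrix.zero_mulVec]
  have hA0 : A ≠ 0 := by
    intro h
    obtain ⟨w, hw⟩ := hv
    change A.mulVec w = v at hw
    rw [h, Matrix.zero_mulVec] at hw
    exact hv0 (Subtype.ext hw.symm)
  have hpow : ∀ n : ℕ,
      ((σ ^ n : Matrix.GeneralLinearGroup ι k) : Matrix ι ι k) =
        1 + (∑ i ∈ Finset.range n, (μ + 1) ^ i) • A := by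
    intro n
    induction n with
    | zero => simp
    | succ n ih =>
      have hσA : (σ : Matrix ι ι k) = 1 + A := by rw [hA]; abel
      rw [pow_succ, Units.val_mul, ih, geom_sum_succ, hσA, add_mul, one_mul, mul_add, mul_one,
        smul_mul_assoc, hsq]
      module
  obtain ⟨N, hN, hσN⟩ := isOfFinOrder_iff_pow_eq_one.mp hfin
  have hfinμ : IsOfFinOrder (μ + 1) := by
    refine isOfFinOrder_iff_pow_eq_one.mpr ⟨N, hN, ?_⟩
    have h := hpow N
    rw [hσN, Units.val_one, left_eq_add, smul_eq_zero, or_iff_left hA0] at h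
    have h' := geom_sum_mul (μ + 1) N
    rw [h, zero_mul] at h'
    exact sub_eq_zero.mp h'.symm
  have : NeZero (orderOf (μ + 1)) := ⟨hfinμ.orderOf_pos.ne'⟩
  refine ⟨orderOf (μ + 1), (IsPrimitiveRoot.orderOf (μ + 1)).neZero'.out, Units.ext ?_⟩
  have h := geom_sum_mul (μ + 1) (orderOf (μ + 1))
  rw [pow_orderOf_eq_one, sub_self, add_sub_cancel_right, mul_eq_zero, or_iff_left hμ0] at h
  rw [hpow, h, zero_smul, add_zero, Units.val_one]

/-- A finite abelian group generated by homologies has order prime to the characteristic. -/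
lemma natCast_card_ne_zero_of_closure_isHomology
    (D : Subgroup (Matrix.GeneralLinearGroup ι k)) [Finite D]
    (hab : ∀ a ∈ D, ∀ b ∈ D, a * b = b * a)
    (hgen : Subgroup.closure {σ | σ ∈ D ∧ IsHomology σ} = D) : (Nat.card D : k) ≠ 0 := by
  have key : ∀ σ ∈ D, ∃ n : ℕ, (n : k) ≠ 0 ∧ σ ^ n = 1 := by
    intro σ hσ
    rw [← hgen] at hσ
    induction hσ using Subgroup.closure_induction with
    | mem σ hσ =>
      refine hσ.2.exists_pow_eq_one ?_
      exact D.subtype.isOfFinOrder (isOfFinOrder_of_finite (⟨σ, hσ.1⟩ : D))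
    | one => exact ⟨1, by simp, one_pow 1⟩
    | mul x y hx hy ihx ihy =>
      obtain ⟨a, ha, hxa⟩ := ihx
      obtain ⟨b, hb, hyb⟩ := ihy
      rw [hgen] at hx hy
      refine ⟨a * b, by push_cast; exact mul_ne_zero ha hb, ?_⟩
      rw [Commute.mul_pow (hab x hx y hy), pow_mul, hxa, mul_comm a b, pow_mul y, hyb, one_pow,
        one_pow, one_mul]
    | inv x _ ih => exact ih.imp fun n hn => ⟨hn.1, by rw [inv_pow, hn.2, inv_one]⟩
  intro hcard
  have hdvd := (ringChar.spec k _).mp hcard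
  have hprime : (ringChar k).Prime := by
    refine (CharP.char_is_prime_or_zero k (ringChar k)).resolve_right fun h0 => ?_
    rw [h0, zero_dvd_iff] at hdvd
    exact Nat.card_pos.ne' hdvd
  have : Fact (ringChar k).Prime := ⟨hprime⟩
  obtain ⟨g, hg⟩ := exists_prime_orderOf_dvd_card' (G := D) (ringChar k) hdvd
  obtain ⟨n, hn, hgn⟩ := key g g.2
  refine hn ((ringChar.spec k n).mpr ?_)
  rw [← hg]
  exact orderOf_dvd_of_pow_eq_one (Subtype.ext hgn)

end HomologyOrder

section Splitting

variable {α β : Type*}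

variable (k α β) in
/-- Polynomials on `α ⊕ β` as polynomials in the variables `β` over the polynomials on `α`. -/
noncomputable def sumCoeffEquiv :
    MvPolynomial (α ⊕ β) k ≃ₐ[k] MvPolynomial β (MvPolynomial α k) :=
  (renameEquiv k (Equiv.sumComm α β)).trans (sumAlgEquiv k β α)

@[simp]
lemma sumCoeffEquiv_X_inl (a : α) : sumCoeffEquiv k α β (X (Sum.inl a)) = C (X a) := by
  simp [sumCoeffEquiv]

@[simp]
lemma sumCoeffEquiv_X_inr (b : β) : sumCoeffEquiv k α β (X (Sum.inr b)) = X b := by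
  simp [sumCoeffEquiv]

lemma sumCoeffEquiv_rename_inl (s : MvPolynomial α k) :
    sumCoeffEquiv k α β (rename Sum.inl s) = C s := by
  have h : (sumCoeffEquiv k α β).toAlgHom.comp (rename Sum.inl) =
      IsScalarTower.toAlgHom k (MvPolynomial α k) (MvPolynomial β (MvPolynomial α k)) := by
    ext1 a
    simp [algebraMap_eq]
  exact DFunLike.congr_fun h s

lemma sumCoeffEquiv_rename_inl_mul_rename_inr (u : β →₀ ℕ) (s : MvPolynomial α k) :
    sumCoeffEquiv k α β (rename Sum.inl s * rename Sum.inr (monomial u 1)) = monomial u s := by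
  rw [map_mul, sumCoeffEquiv_rename_inl, monomial_eq, monomial_eq]
  simp only [C_1, one_mul, Finsupp.prod, map_prod, map_pow, rename_X, sumCoeffEquiv_X_inr]

lemma monomial_eq_rename_inl_mul_rename_inr (e : α ⊕ β →₀ ℕ) (c : k) :
    monomial e c = rename Sum.inl (monomial (e.comapDomain Sum.inl Sum.inl_injective.injOn) c) *
      rename Sum.inr (monomial (e.comapDomain Sum.inr Sum.inr_injective.injOn) 1) := by
  rw [rename_monomial, rename_monomial, monomial_mul, mul_one]
  refine congrArg (fun u => monomial u c) ?_
  ext (a | b)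
  · rw [Finsupp.add_apply, Finsupp.mapDomain_apply Sum.inl_injective,
      Finsupp.mapDomain_of_notMem_range _ _ (by simp)]
    simp
  · rw [Finsupp.add_apply, Finsupp.mapDomain_apply Sum.inr_injective,
      Finsupp.mapDomain_of_notMem_range _ _ (by simp)]
    simp

/-- Apply an additive map to every coefficient of a polynomial. -/
noncomputable def mapCoeffs {R σ : Type*} [CommSemiring R] (φ : R →+ R) :
    MvPolynomial σ R →+ MvPolynomial σ R :=
  AddMonoidAlgebra.coeffAddEquiv.symm.toAddMonoidHom.comp
    ((Finsupp.mapRange.addMonoidHom φ).comp AddMonoidAlgebra.coeffAddEquiv.toAddMonoidHom)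

lemma coeff_mapCoeffs {R σ : Type*} [CommSemiring R] (φ : R →+ R) (p : MvPolynomial σ R)
    (u : σ →₀ ℕ) : coeff u (mapCoeffs φ p) = φ (coeff u p) :=
  rfl

lemma mapCoeffs_monomial {R σ : Type*} [CommSemiring R] (φ : R →+ R) (u : σ →₀ ℕ) (r : R) :
    mapCoeffs φ (monomial u r) = monomial u (φ r) := by
  classical
  ext v
  rw [coeff_mapCoeffs, coeff_monomial, coeff_monomial]
  split_ifs <;> simp

/-- Extend an additive endomorphism of `k[α]` to `k[α ⊕ β]`, linearly in the variables `β`. -/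
noncomputable def extendSum (φ : MvPolynomial α k →+ MvPolynomial α k) :
    MvPolynomial (α ⊕ β) k →+ MvPolynomial (α ⊕ β) k :=
  (sumCoeffEquiv k α β).symm.toRingEquiv.toAddEquiv.toAddMonoidHom.comp
    ((mapCoeffs φ).comp (sumCoeffEquiv k α β).toRingEquiv.toAddEquiv.toAddMonoidHom)

lemma sumCoeffEquiv_extendSum (φ : MvPolynomial α k →+ MvPolynomial α k)
    (p : MvPolynomial (α ⊕ β) k) :
    sumCoeffEquiv k α β (extendSum φ p) = mapCoeffs φ (sumCoeffEquiv k α β p) :=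
  (sumCoeffEquiv k α β).apply_symm_apply _

lemma extendSum_rename_mul_rename (φ : MvPolynomial α k →+ MvPolynomial α k)
    (s : MvPolynomial α k) (u : β →₀ ℕ) :
    extendSum φ (rename Sum.inl s * rename Sum.inr (monomial u 1)) =
      rename Sum.inl (φ s) * rename Sum.inr (monomial u 1) := by
  apply (sumCoeffEquiv k α β).injective
  rw [sumCoeffEquiv_extendSum, sumCoeffEquiv_rename_inl_mul_rename_inr, mapCoeffs_monomial,
    sumCoeffEquiv_rename_inl_mul_rename_inr]

lemma isHomogeneous_extendSum [Fintype α] [Fintype β] {φ : MvPolynomial α k →+ MvPolynomial α k}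
    (hφ : ∀ p d, p.IsHomogeneous d → (φ p).IsHomogeneous d) {p : MvPolynomial (α ⊕ β) k} {d : ℕ}
    (hp : p.IsHomogeneous d) : (extendSum φ p).IsHomogeneous d := by
  rw [p.as_sum, map_sum]
  refine IsHomogeneous.sum _ _ _ fun e he => ?_
  rw [monomial_eq_rename_inl_mul_rename_inr, extendSum_rename_mul_rename]
  have hdeg : (e.comapDomain Sum.inl Sum.inl_injective.injOn).degree +
      (e.comapDomain Sum.inr Sum.inr_injective.injOn).degree = d := by
    rw [hp.degree_eq_sum_deg_support he, ← Finsupp.degree_apply, Finsupp.degree_eq_sum,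
      Finsupp.degree_eq_sum, Finsupp.degree_eq_sum, Fintype.sum_sum_type]
    rfl
  rw [← hdeg]
  exact (hφ _ _ (isHomogeneous_monomial _ rfl)).rename_isHomogeneous.mul
    (isHomogeneous_monomial _ rfl).rename_isHomogeneous

end Splitting

section BlockAction

variable {α β : Type*} [Fintype α] [DecidableEq α] [Fintype β] [DecidableEq β]

lemma galAct_blockHom_rename_inl (t : Matrix.GeneralLinearGroup α k)
    (d : Matrix.GeneralLinearGroup β k) (s : MvPolynomial α k) :
    galAct (blockHom (t, d)) (rename Sum.inl s) = rename Sum.inl (galAct t s) := by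
  have h : (galAct (blockHom (t, d))).comp (rename Sum.inl) =
      (rename Sum.inl).comp (galAct t) := by
    ext1 i
    simp [blockHom]
  exact DFunLike.congr_fun h s

lemma sumCoeffEquiv_galAct (t : Matrix.GeneralLinearGroup α k) (p : MvPolynomial (α ⊕ β) k) :
    sumCoeffEquiv k α β (galAct (blockHom (t, 1)) p) =
      map (galAct t).toRingHom (sumCoeffEquiv k α β p) := by
  have h : (sumCoeffEquiv k α β).toAlgHom.comp (galAct (blockHom (t, 1))) =
      (mapAlgHom (galAct t)).comp (sumCoeffEquiv k α β).toAlgHom := by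
    ext1 i
    rcases i with a | b
    · have h := sumCoeffEquiv_rename_inl (β := β) (galAct t (X a))
      rw [← galAct_blockHom_rename_inl t 1, rename_X] at h
      simpa using h
    · simp [blockHom, Matrix.one_apply]
  exact DFunLike.congr_fun h p

lemma extendSum_mul {φ : MvPolynomial α k →+ MvPolynomial α k}
    {T : Subgroup (Matrix.GeneralLinearGroup α k)}
    (hφ : ∀ f ∈ invariants T, ∀ p, φ (f * p) = f * φ p) {f : MvPolynomial (α ⊕ β) k}
    (hf : ∀ t ∈ T, galAct (blockHom (t, 1)) f = f) (p : MvPolynomial (α ⊕ β) k) :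
    extendSum φ (f * p) = f * extendSum φ p := by
  have hcoeff : ∀ u, coeff u (sumCoeffEquiv k α β f) ∈ invariants T := by
    intro u t ht
    have h := congrArg (coeff u) (sumCoeffEquiv_galAct t f)
    rw [hf t ht, coeff_map] at h
    exact h.symm
  apply (sumCoeffEquiv k α β).injective
  rw [sumCoeffEquiv_extendSum, map_mul (sumCoeffEquiv k α β), map_mul (sumCoeffEquiv k α β),
    sumCoeffEquiv_extendSum]
  ext1 u
  classical
  rw [coeff_mapCoeffs, coeff_mul, coeff_mul, map_sum]
  exact Finset.sum_congr rfl fun x _ => by rw [hφ _ (hcoeff _), coeff_mapCoeffs]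

lemma galAct_extendSum {φ : MvPolynomial α k →+ MvPolynomial α k}
    {T : Subgroup (Matrix.GeneralLinearGroup α k)} (hφ : ∀ p, φ p ∈ invariants T)
    {t : Matrix.GeneralLinearGroup α k} (ht : t ∈ T) (p : MvPolynomial (α ⊕ β) k) :
    galAct (blockHom (t, 1)) (extendSum φ p) = extendSum φ p := by
  apply (sumCoeffEquiv k α β).injective
  rw [sumCoeffEquiv_galAct, sumCoeffEquiv_extendSum]
  ext1 u
  rw [coeff_map, coeff_mapCoeffs]
  exact hφ _ t ht

lemma DSP.of_prod {T : Subgroup (Matrix.GeneralLinearGroup α k)}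
    {D : Subgroup (Matrix.GeneralLinearGroup β k)} (h : DSP ((T.prod D).map blockHom)) :
    DSP T := by
  obtain ⟨Φ, hmem, hmul, hone, hdeg⟩ := (dsp_iff_exists_retraction _).mp h
  let ρ : MvPolynomial (α ⊕ β) k →ₐ[k] MvPolynomial α k := aeval (Sum.elim X 0)
  have hρ : ∀ s : MvPolynomial α k, ρ (rename Sum.inl s) = s := fun s => by
    simp only [ρ, aeval_rename, Sum.elim_comp_inl, aeval_X_left_apply]
  have hρdeg : ∀ (p : MvPolynomial (α ⊕ β) k) d, p.IsHomogeneous d → (ρ p).IsHomogeneous d := by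
    intro p d hp
    have h := hp.aeval (Sum.elim X 0 : α ⊕ β → MvPolynomial α k) (n := 1) (by
      rintro (a | b)
      · exact isHomogeneous_X k a
      · exact isHomogeneous_zero _ _ _)
    rwa [one_mul] at h
  have hρact : ∀ t p, ρ (galAct (blockHom (t, (1 : Matrix.GeneralLinearGroup β k))) p) =
      galAct t (ρ p) := by
    intro t p
    have h : ρ.comp (galAct (blockHom (t, (1 : Matrix.GeneralLinearGroup β k)))) =
        (galAct t).comp ρ := by
      ext1 i
      rcases i with a | b <;> simp [ρ, blockHom]
    exact DFunLike.congr_fun h p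
  refine (dsp_iff_exists_retraction T).mpr
    ⟨ρ.toRingHom.toAddMonoidHom.comp (Φ.comp (rename Sum.inl).toRingHom.toAddMonoidHom),
      ?_, ?_, ?_, ?_⟩
  · intro p t ht
    change galAct t (ρ (Φ (rename Sum.inl p))) = ρ (Φ (rename Sum.inl p))
    rw [← hρact, hmem _ _ ⟨(t, 1), ⟨ht, one_mem D⟩, rfl⟩]
  · intro f hf p
    change ρ (Φ (rename Sum.inl (f * p))) = f * ρ (Φ (rename Sum.inl p))
    have hf' : rename Sum.inl f ∈ invariants ((T.prod D).map blockHom) := by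
      rintro _ ⟨⟨t, d⟩, ⟨ht, _⟩, rfl⟩
      rw [galAct_blockHom_rename_inl, hf t ht]
    rw [map_mul, hmul _ hf', map_mul, hρ]
  · change ρ (Φ (rename Sum.inl 1)) = 1
    rw [map_one, hone, map_one]
  · exact fun p d hp => hρdeg _ _ (hdeg _ _ hp.rename_isHomogeneous)

lemma DSP.prod {T : Subgroup (Matrix.GeneralLinearGroup α k)}
    {D : Subgroup (Matrix.GeneralLinearGroup β k)} [Finite D] (hcard : (Nat.card D : k) ≠ 0)
    (h : DSP T) : DSP ((T.prod D).map blockHom) := by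
  obtain ⟨φ, hmem, hmul, hone, hdeg⟩ := (dsp_iff_exists_retraction _).mp h
  have := Fintype.ofFinite D
  rw [Nat.card_eq_fintype_card] at hcard
  let act : D → MvPolynomial (α ⊕ β) k →ₐ[k] MvPolynomial (α ⊕ β) k := fun d =>
    galAct (blockHom ((1 : Matrix.GeneralLinearGroup α k), (d : Matrix.GeneralLinearGroup β k)))
  let reynolds : MvPolynomial (α ⊕ β) k →ₗ[k] MvPolynomial (α ⊕ β) k :=
    (Fintype.card D : k)⁻¹ • ∑ d : D, (act d).toLinearMap
  have hreynolds : ∀ p, reynolds p = (Fintype.card D : k)⁻¹ • ∑ d : D, act d p := fun p => by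
    simp [reynolds]
  have hext : extendSum (β := β) φ 1 = 1 := by
    have h := extendSum_rename_mul_rename φ (1 : MvPolynomial α k) (0 : β →₀ ℕ)
    rw [hone] at h
    simpa using h
  refine (dsp_iff_exists_retraction _).mpr
    ⟨reynolds.toAddMonoidHom.comp (extendSum φ), ?_, ?_, ?_, ?_⟩
  · rintro p _ ⟨⟨t, d⟩, ⟨ht, hd⟩, rfl⟩
    change galAct (blockHom (t, d)) (reynolds (extendSum φ p)) = reynolds (extendSum φ p)
    rw [hreynolds, map_smul, map_sum]
    refine congrArg _ ?_
    refine Fintype.sum_equiv (Equiv.mulLeft (⟨d, hd⟩ : D)) _ _ fun e => ?_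
    have hfac : blockHom (t, d) * blockHom (1, e.1) =
        blockHom (1, d * e.1) * blockHom (t, 1) := by
      rw [← map_mul, ← map_mul]
      simp
    change galAct (blockHom (t, d)) (galAct (blockHom (1, e.1)) (extendSum φ p)) =
      galAct (blockHom (1, d * e.1)) (extendSum φ p)
    rw [← galAct_mul_apply, hfac, galAct_mul_apply, galAct_extendSum hmem ht]
  · intro f hf p
    change reynolds (extendSum φ (f * p)) = f * reynolds (extendSum φ p)
    rw [extendSum_mul hmul fun t ht => hf _ ⟨(t, 1), ⟨ht, one_mem D⟩, rfl⟩, hreynolds, hreynolds,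
      mul_smul_comm, Finset.mul_sum]
    refine congrArg _ (Finset.sum_congr rfl fun d _ => ?_)
    have hd : act d f = f := hf _ ⟨(1, d), ⟨one_mem T, d.2⟩, rfl⟩
    rw [map_mul, hd]
  · change reynolds (extendSum φ 1) = 1
    rw [hext, hreynolds]
    simp only [map_one, Finset.sum_const, Finset.card_univ]
    rw [← Nat.cast_smul_eq_nsmul k, smul_smul, inv_mul_cancel₀ hcard, one_smul]
  · intro p d hp
    change (reynolds (extendSum φ p)).IsHomogeneous d
    rw [hreynolds]
    exact (homogeneousSubmodule _ k d).smul_mem _ ((homogeneousSubmodule _ k d).sum_mem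
      fun e _ => isHomogeneous_galAct _ (isHomogeneous_extendSum hdeg hp))

end BlockAction

/-- Let `G = T × D` be a finite abelian pseudo-reflection group with `T`
the transvection subgroup and `D` the homology subgroup, in coordinates adapted to
`V = V^D ⊕ V_D` (so `G` is the block-diagonal product of `T < GL(V^D)` and `D < GL(V_D)`).
Then the direct summand property holds for the `G`-action on `V` if and only if it holds for
the `T`-action on `V^D`. -/
theorem statement13 {k : Type*} [Field k] {m r : ℕ}
    (T : Subgroup (Matrix.GeneralLinearGroup (Fin m) k)) [Finite ↥T]
    (D : Subgroup (Matrix.GeneralLinearGroup (Fin r) k)) [Finite ↥D]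
    (hTab : ∀ a ∈ T, ∀ b ∈ T, a * b = b * a)
    (hDab : ∀ a ∈ D, ∀ b ∈ D, a * b = b * a)
    (hTgen : Subgroup.closure {τ | τ ∈ T ∧ IsTransvection τ} = T)
    (hDgen : Subgroup.closure {σ | σ ∈ D ∧ IsHomology σ} = D)
    (G : Subgroup (Matrix.GeneralLinearGroup (Fin m ⊕ Fin r) k))
    (hG : G = (T.prod D).map blockHom) :
    DSP G ↔ DSP T := by
  subst hG
  exact ⟨DSP.of_prod, DSP.prod (natCast_card_ne_zero_of_closure_isHomology D hDab hDgen)⟩
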